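/- Let ξ, δ ∈ ℝ and 1 ≤ p < ∞. The dual Hardy-type operator H_∞^ξ is of strong type (p,p) with respect to (ℝ₊, x^δ dx) if and only if −ξp − 1 < δ. Moreover, H_∞^ξ is of strong type (∞,∞) if and only if ξ > 0. -/

import Mathlib

open MeasureTheory Set ENNReal
open scoped NNReal

noncomputable section

/-- The measure `x^δ dx` on `(0,∞)`. -/
def powMeasure (δ : ℝ) : Measure ℝ :=
  (volume.restrict (Ioi (0:ℝ))).withDensity (fun x => ENNReal.ofReal (x ^ δ))

/-- `f ∈ L^p(ℝ₊, x^δ dx)` for a real exponent `p`. -/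
def MemLpPow (f : ℝ → ℝ) (p δ : ℝ) : Prop :=
  AEMeasurable f (powMeasure δ) ∧
    ∫⁻ x, ENNReal.ofReal |f x| ^ p ∂(powMeasure δ) < ⊤

/-- `T` is of strong type `(p,p)` with respect to `(ℝ₊, x^δ dx)`. -/
def IsStrongType (T : (ℝ → ℝ) → (ℝ → ℝ)) (p δ : ℝ) : Prop :=
  ∃ C : ℝ≥0, ∀ f : ℝ → ℝ, MemLpPow f p δ →
    ∫⁻ x, ENNReal.ofReal |T f x| ^ p ∂(powMeasure δ) ≤
      C * ∫⁻ x, ENNReal.ofReal |f x| ^ p ∂(powMeasure δ)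

/-- `T` is of strong type `(∞,∞)`, i.e. bounded on `L^∞(ℝ₊, dx)`. -/
def IsStrongTypeInfty (T : (ℝ → ℝ) → (ℝ → ℝ)) : Prop :=
  ∃ C : ℝ≥0, ∀ f : ℝ → ℝ,
    eLpNorm (T f) ⊤ (volume.restrict (Ioi (0:ℝ))) ≤
      C * eLpNorm f ⊤ (volume.restrict (Ioi (0:ℝ)))

/-- `T` is of weak type `(p,p)` with respect to `(ℝ₊, x^δ dx)`. -/
def IsWeakType (T : (ℝ → ℝ) → (ℝ → ℝ)) (p δ : ℝ) : Prop :=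
  ∃ C : ℝ≥0, ∀ f : ℝ → ℝ, MemLpPow f p δ → ∀ l : ℝ, 0 < l →
    ENNReal.ofReal (l ^ p) * powMeasure δ {y | l < |T f y|} ≤
      C * ∫⁻ x, ENNReal.ofReal |f x| ^ p ∂(powMeasure δ)

/-- `T` is of restricted weak type `(p,p)` with respect to `(ℝ₊, x^δ dx)`:
the weak type inequality holds uniformly over indicator functions of sets of
finite `x^δ dx` measure. -/
def IsRestrictedWeakType (T : (ℝ → ℝ) → (ℝ → ℝ)) (p δ : ℝ) : Prop :=
  ∃ C : ℝ≥0, ∀ E : Set ℝ, MeasurableSet E → powMeasure δ E < ⊤ → ∀ l : ℝ, 0 < l →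
    ENNReal.ofReal (l ^ p) * powMeasure δ {y | l < |T (E.indicator 1) y|} ≤
      C * powMeasure δ E

/-- The dual Hardy-type operator `H_∞^ξ`. -/
def Hinf (ξ : ℝ) (f : ℝ → ℝ) (x : ℝ) : ℝ :=
  x ^ ξ * ∫ y in Ioi x, f y * y ^ (-ξ - 1)

/-- Jensen's inequality for the power `p ≥ 1` and a density `w`. -/
theorem lintegral_mul_rpow_le {α : Type*} [MeasurableSpace α] (μ : Measure α)
    {g w : α → ℝ≥0∞} (hg : Measurable g) (hw : Measurable w) {p : ℝ} (hp : 1 ≤ p) :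
    (∫⁻ a, w a * g a ∂μ) ^ p ≤ (∫⁻ a, w a ∂μ) ^ (p - 1) * ∫⁻ a, w a * g a ^ p ∂μ := by
  have hp0 : 0 < p := by linarith
  have h := eLpNorm'_le_eLpNorm'_mul_rpow_measure_univ (p := 1) (q := p) (μ := μ.withDensity w)
    one_pos hp hg.aestronglyMeasurable
  simp only [eLpNorm', enorm_eq_self, ENNReal.rpow_one, div_one,
    withDensity_apply _ MeasurableSet.univ, Measure.restrict_univ] at h
  rw [lintegral_withDensity_eq_lintegral_mul _ hw hg,
    lintegral_withDensity_eq_lintegral_mul _ hw (hg.pow_const p)] at h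
  have h2 := ENNReal.rpow_le_rpow h hp0.le
  rw [ENNReal.mul_rpow_of_nonneg _ _ hp0.le, ← ENNReal.rpow_mul, ← ENNReal.rpow_mul,
    one_div_mul_cancel hp0.ne', ENNReal.rpow_one,
    show (1 - 1 / p) * p = p - 1 by field_simp] at h2
  exact h2.trans_eq (mul_comm _ _)

theorem lintegral_Ioi_rpow {a x : ℝ} (ha : 0 < a) (hx : 0 < x) :
    ∫⁻ y in Ioi x, ENNReal.ofReal (y ^ (-a - 1)) = ENNReal.ofReal (x ^ (-a) / a) := by
  rw [← ofReal_integral_eq_lintegral_ofReal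
    (integrableOn_Ioi_rpow_of_lt (by linarith) hx), integral_Ioi_rpow_of_lt (by linarith) hx]
  · congr 1
    rw [sub_add_cancel, neg_div_neg_eq]
  · filter_upwards [ae_restrict_mem measurableSet_Ioi] with y hy
    exact Real.rpow_nonneg (hx.trans hy).le _

theorem lintegral_Ioo_rpow {a y : ℝ} (ha : 0 < a) (hy : 0 < y) :
    ∫⁻ x in Ioo 0 y, ENNReal.ofReal (x ^ (a - 1)) = ENNReal.ofReal (y ^ a / a) := by
  have hi : IntervalIntegrable (fun x : ℝ => x ^ (a - 1)) volume 0 y :=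
    intervalIntegral.intervalIntegrable_rpow' (by linarith)
  rw [restrict_Ioo_eq_restrict_Ioc, ← ofReal_integral_eq_lintegral_ofReal
    ((intervalIntegrable_iff_integrableOn_Ioc_of_le hy.le).1 hi),
    ← intervalIntegral.integral_of_le hy.le, integral_rpow (Or.inl (by linarith))]
  · congr 1
    rw [sub_add_cancel, Real.zero_rpow ha.ne', sub_zero]
  · filter_upwards [ae_restrict_mem measurableSet_Ioc] with x hx
    exact Real.rpow_nonneg hx.1.le _

theorem lintegral_powMeasure (δ : ℝ) (g : ℝ → ℝ≥0∞) :
    ∫⁻ x, g x ∂(powMeasure δ) = ∫⁻ x in Ioi 0, ENNReal.ofReal (x ^ δ) * g x := by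
  rw [powMeasure, lintegral_withDensity_eq_lintegral_mul_non_measurable _ (by fun_prop)
    (by simp)]
  rfl

theorem volume_restrict_Ioi_absolutelyContinuous_powMeasure (δ : ℝ) :
    volume.restrict (Ioi (0 : ℝ)) ≪ powMeasure δ := by
  refine withDensity_absolutelyContinuous' (by fun_prop) ?_
  filter_upwards [ae_restrict_mem measurableSet_Ioi] with x hx
  simpa using Real.rpow_pos_of_pos hx δ

/-- The pointwise estimate behind Hardy's inequality, where `a = (δ + 1) / p + ξ`. -/
theorem dual_hardy_pointwise {ξ δ p a : ℝ} (hp : 1 ≤ p) (ha : 0 < a)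
    (hap : a * p = ξ * p + δ + 1) {F : ℝ → ℝ≥0∞} (hF : Measurable F) {x : ℝ} (hx : 0 < x) :
    ENNReal.ofReal (x ^ δ) *
      (ENNReal.ofReal (x ^ ξ) * ∫⁻ y in Ioi x, F y * ENNReal.ofReal (y ^ (-ξ - 1))) ^ p ≤
      ENNReal.ofReal (a⁻¹ ^ (p - 1)) * (ENNReal.ofReal (x ^ (a - 1)) *
        ∫⁻ y in Ioi x, ENNReal.ofReal (y ^ (δ - a)) * F y ^ p) := by
  have hp0 : 0 ≤ p := by linarith
  have h := lintegral_mul_rpow_le (volume.restrict (Ioi x))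
    (g := fun y => ENNReal.ofReal (y ^ (a - ξ)) * F y)
    (w := fun y => ENNReal.ofReal (y ^ (-a - 1))) (by fun_prop) (by fun_prop) hp
  rw [lintegral_Ioi_rpow ha hx] at h
  have e1 : ∫⁻ y in Ioi x, ENNReal.ofReal (y ^ (-a - 1)) * (ENNReal.ofReal (y ^ (a - ξ)) * F y)
      = ∫⁻ y in Ioi x, F y * ENNReal.ofReal (y ^ (-ξ - 1)) := by
    refine setLIntegral_congr_fun measurableSet_Ioi fun y hy => ?_
    have hy0 : 0 < y := hx.trans hy
    rw [← mul_assoc, ← ENNReal.ofReal_mul (by positivity), ← Real.rpow_add hy0, mul_comm]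
    ring_nf
  have e2 : ∫⁻ y in Ioi x, ENNReal.ofReal (y ^ (-a - 1)) *
      (ENNReal.ofReal (y ^ (a - ξ)) * F y) ^ p
      = ∫⁻ y in Ioi x, ENNReal.ofReal (y ^ (δ - a)) * F y ^ p := by
    refine setLIntegral_congr_fun measurableSet_Ioi fun y hy => ?_
    have hy0 : 0 < y := hx.trans hy
    rw [ENNReal.mul_rpow_of_nonneg _ _ hp0, ENNReal.ofReal_rpow_of_nonneg (by positivity) hp0,
      ← Real.rpow_mul hy0.le, ← mul_assoc, ← ENNReal.ofReal_mul (by positivity),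
      ← Real.rpow_add hy0]
    rw [show -a - 1 + (a - ξ) * p = δ - a by linarith]
  rw [e1, e2] at h
  rw [ENNReal.mul_rpow_of_nonneg _ _ hp0, ENNReal.ofReal_rpow_of_nonneg (by positivity) hp0,
    ← mul_assoc]
  refine (mul_le_mul_right h _).trans_eq ?_
  rw [ENNReal.ofReal_rpow_of_nonneg (by positivity) (by linarith), ← mul_assoc, ← mul_assoc,
    ← ENNReal.ofReal_mul (by positivity), ← ENNReal.ofReal_mul (by positivity),
    ← ENNReal.ofReal_mul (by positivity)]
  congr 2
  rw [div_eq_mul_inv, Real.mul_rpow (by positivity) (by positivity), ← Real.rpow_mul hx.le,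
    ← Real.rpow_mul hx.le, ← mul_assoc, ← Real.rpow_add hx, ← Real.rpow_add hx, mul_comm]
  congr 2
  linarith

theorem lintegral_Ioi_lintegral_Ioi_swap {u v : ℝ → ℝ≥0∞} (hu : Measurable u)
    (hv : Measurable v) :
    ∫⁻ x in Ioi (0 : ℝ), u x * ∫⁻ y in Ioi x, v y =
      ∫⁻ y in Ioi (0 : ℝ), v y * ∫⁻ x in Ioo 0 y, u x := by
  have hm : Measurable (fun z : ℝ × ℝ => {z : ℝ × ℝ | z.1 < z.2}.indicator
      (fun z => u z.1 * v z.2) z) :=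
    Measurable.indicator (by fun_prop) (measurableSet_lt measurable_fst measurable_snd)
  have hswap := lintegral_lintegral_swap (μ := volume.restrict (Ioi (0 : ℝ)))
    (ν := volume.restrict (Ioi (0 : ℝ)))
    (f := fun x y => {z : ℝ × ℝ | z.1 < z.2}.indicator (fun z => u z.1 * v z.2) (x, y))
    hm.aemeasurable
  convert hswap using 1
  · refine setLIntegral_congr_fun measurableSet_Ioi fun x hx => ?_
    have : (fun y => {z : ℝ × ℝ | z.1 < z.2}.indicator (fun z => u z.1 * v z.2) (x, y)) =
        (Ioi x).indicator fun y => u x * v y := by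
      ext y; simp [indicator]
    simp only [this]
    rw [lintegral_indicator measurableSet_Ioi, Measure.restrict_restrict measurableSet_Ioi,
      inter_eq_self_of_subset_left (Ioi_subset_Ioi (le_of_lt hx)), lintegral_const_mul _ hv]
  · refine setLIntegral_congr_fun measurableSet_Ioi fun y hy => ?_
    have : (fun x => {z : ℝ × ℝ | z.1 < z.2}.indicator (fun z => u z.1 * v z.2) (x, y)) =
        (Iio y).indicator fun x => u x * v y := by
      ext x; simp [indicator]
    simp only [this]
    rw [lintegral_indicator measurableSet_Iio, Measure.restrict_restrict measurableSet_Iio,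
      inter_comm, Ioi_inter_Iio, lintegral_mul_const _ hu, mul_comm]

theorem dual_hardy_inequality {ξ δ p a : ℝ} (hp : 1 ≤ p) (ha : 0 < a)
    (hap : a * p = ξ * p + δ + 1) {F : ℝ → ℝ≥0∞} (hF : Measurable F) :
    ∫⁻ x in Ioi 0, ENNReal.ofReal (x ^ δ) *
      (ENNReal.ofReal (x ^ ξ) * ∫⁻ y in Ioi x, F y * ENNReal.ofReal (y ^ (-ξ - 1))) ^ p ≤
      ENNReal.ofReal (a⁻¹ ^ p) * ∫⁻ y in Ioi 0, ENNReal.ofReal (y ^ δ) * F y ^ p := by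
  refine (setLIntegral_mono' measurableSet_Ioi fun x hx =>
    dual_hardy_pointwise hp ha hap hF hx).trans_eq ?_
  rw [lintegral_const_mul' _ _ ofReal_ne_top,
    lintegral_Ioi_lintegral_Ioi_swap (by fun_prop) (by fun_prop),
    ← lintegral_const_mul' _ _ ofReal_ne_top, ← lintegral_const_mul' _ _ ofReal_ne_top]
  refine setLIntegral_congr_fun measurableSet_Ioi fun y (hy : 0 < y) => ?_
  rw [lintegral_Ioo_rpow ha hy, mul_right_comm, ← ENNReal.ofReal_mul (by positivity),
    ← mul_assoc, ← mul_assoc, ← ENNReal.ofReal_mul (by positivity),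
    ← ENNReal.ofReal_mul (by positivity)]
  congr 2
  rw [div_eq_mul_inv, ← mul_assoc (y ^ (δ - a)), ← Real.rpow_add hy, sub_add_cancel,
    mul_comm (y ^ δ), ← mul_assoc, ← Real.rpow_add_one (by positivity), sub_add_cancel]

theorem enorm_Hinf_le (ξ : ℝ) (f : ℝ → ℝ) {x : ℝ} (hx : 0 < x) :
    ‖Hinf ξ f x‖ₑ ≤ ENNReal.ofReal (x ^ ξ) *
      ∫⁻ y in Ioi x, ‖f y‖ₑ * ENNReal.ofReal (y ^ (-ξ - 1)) := by
  rw [Hinf, enorm_mul, Real.enorm_of_nonneg (by positivity)]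
  gcongr
  refine (enorm_integral_le_lintegral_enorm _).trans_eq ?_
  refine setLIntegral_congr_fun measurableSet_Ioi fun y hy => ?_
  have hy0 : 0 < y := hx.trans hy
  rw [enorm_mul, Real.enorm_of_nonneg (by positivity : 0 ≤ y ^ (-ξ - 1))]

theorem isStrongType_Hinf {ξ δ p : ℝ} (hp : 1 ≤ p) (h : -ξ * p - 1 < δ) :
    IsStrongType (Hinf ξ) p δ := by
  have hp0 : 0 < p := by linarith
  set a : ℝ := (ξ * p + δ + 1) / p with ha_def
  have ha : 0 < a := div_pos (by linarith) hp0
  have hap : a * p = ξ * p + δ + 1 := div_mul_cancel₀ _ hp0.ne'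
  refine ⟨(a⁻¹ ^ p).toNNReal, fun f hf => ?_⟩
  have hae := (volume_restrict_Ioi_absolutelyContinuous_powMeasure δ).ae_eq hf.1.ae_eq_mk
  set F : ℝ → ℝ≥0∞ := fun y => ‖hf.1.mk f y‖ₑ
  have hF : Measurable F := hf.1.measurable_mk.enorm
  simp only [lintegral_powMeasure, ← Real.enorm_eq_ofReal_abs]
  calc
    _ ≤ ∫⁻ x in Ioi 0, ENNReal.ofReal (x ^ δ) * (ENNReal.ofReal (x ^ ξ) *
        ∫⁻ y in Ioi x, F y * ENNReal.ofReal (y ^ (-ξ - 1))) ^ p := by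
      refine setLIntegral_mono' measurableSet_Ioi fun x hx => ?_
      gcongr
      refine (enorm_Hinf_le ξ f hx).trans_eq ?_
      congr 1
      refine lintegral_congr_ae ?_
      filter_upwards [ae_restrict_of_ae_restrict_of_subset (Ioi_subset_Ioi (le_of_lt hx)) hae]
        with y hy
      simp only [F, hy]
    _ ≤ _ := dual_hardy_inequality hp ha hap hF
    _ = _ := by
      congr 1
      refine lintegral_congr_ae ?_
      filter_upwards [hae] with y hy
      simp only [F, hy]

theorem isStrongTypeInfty_Hinf {ξ : ℝ} (hξ : 0 < ξ) : IsStrongTypeInfty (Hinf ξ) := by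
  refine ⟨ξ⁻¹.toNNReal, fun f => ?_⟩
  simp only [eLpNorm_exponent_top]
  refine essSup_le_of_ae_le _ ?_
  have hf := enorm_ae_le_eLpNormEssSup f (volume.restrict (Ioi (0 : ℝ)))
  filter_upwards [ae_restrict_mem measurableSet_Ioi] with x (hx : 0 < x)
  set N := eLpNormEssSup f (volume.restrict (Ioi (0 : ℝ)))
  calc
    _ ≤ _ := enorm_Hinf_le ξ f hx
    _ ≤ ENNReal.ofReal (x ^ ξ) * ∫⁻ y in Ioi x, N * ENNReal.ofReal (y ^ (-ξ - 1)) := by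
      refine mul_le_mul_right (lintegral_mono_ae ?_) _
      filter_upwards [ae_restrict_of_ae_restrict_of_subset (Ioi_subset_Ioi hx.le) hf] with y hy
      gcongr
    _ = _ := by
      rw [lintegral_const_mul _ (by fun_prop), lintegral_Ioi_rpow hξ hx, mul_left_comm,
        ← ENNReal.ofReal_mul (by positivity), mul_comm]
      congr 1
      rw [mul_div_assoc', ← Real.rpow_add hx, add_neg_cancel, Real.rpow_zero, one_div]
      rfl

theorem Hinf_indicator_one (ξ : ℝ) {s : Set ℝ} (hs : MeasurableSet s) (x : ℝ) :
    Hinf ξ (s.indicator 1) x = x ^ ξ * ∫ y in Ioi x ∩ s, y ^ (-ξ - 1) := by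
  rw [Hinf, ← setIntegral_indicator hs]
  congr 2
  ext y
  by_cases hy : y ∈ s <;> simp [hy]

theorem lt_of_isStrongType_Hinf {ξ δ p : ℝ} (hp : 1 ≤ p) (h : IsStrongType (Hinf ξ) p δ) :
    -ξ * p - 1 < δ := by
  have hp0 : 0 < p := by linarith
  obtain ⟨C, hC⟩ := h
  have hcont (r : ℝ) : ContinuousOn (fun y : ℝ => y ^ r) (Icc 1 2) :=
    fun y hy => (Real.continuousAt_rpow_const _ _
      (Or.inl (by linarith [hy.1] : (0 : ℝ) < y).ne')).continuousWithinAt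
  have hint (r : ℝ) : IntegrableOn (fun y : ℝ => y ^ r) (Icc 1 2) :=
    (hcont r).integrableOn_compact isCompact_Icc
  set f : ℝ → ℝ := (Icc 1 2).indicator 1
  have hfin : ∫⁻ x, ENNReal.ofReal |f x| ^ p ∂(powMeasure δ) < ⊤ := by
    rw [lintegral_powMeasure]
    have : (fun x => ENNReal.ofReal (x ^ δ) * ENNReal.ofReal |f x| ^ p) =
        (Icc (1 : ℝ) 2).indicator fun x => ENNReal.ofReal (x ^ δ) := by
      ext x
      by_cases hx : x ∈ Icc (1 : ℝ) 2 <;> simp [f, hx, hp0]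
    rw [this, lintegral_indicator measurableSet_Icc, Measure.restrict_restrict measurableSet_Icc,
      inter_eq_self_of_subset_left (Icc_subset_Ioi_iff one_le_two |>.2 one_pos)]
    exact (hint δ).lintegral_lt_top
  have hfm : AEMeasurable f (powMeasure δ) :=
    (measurable_one.indicator measurableSet_Icc).aemeasurable
  have hT := (hC f ⟨hfm, hfin⟩).trans_lt (ENNReal.mul_lt_top coe_lt_top hfin)
  set c : ℝ := ∫ y in Icc 1 2, y ^ (-ξ - 1)
  have hc : 0 < c := by
    refine (setIntegral_pos_iff_support_of_nonneg_ae ?_ (hint _)).2 ?_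
    · filter_upwards [ae_restrict_mem measurableSet_Icc] with y hy
      exact Real.rpow_nonneg (by linarith [hy.1]) _
    · refine lt_of_lt_of_le (b := volume (Icc (1 : ℝ) 2)) (by simp) (measure_mono fun y hy => ?_)
      exact ⟨(Real.rpow_pos_of_pos (by linarith [hy.1]) _).ne', hy⟩
  have hH {x : ℝ} (hx : x ∈ Ioo (0 : ℝ) 1) : Hinf ξ f x = x ^ ξ * c := by
    rw [Hinf_indicator_one ξ measurableSet_Icc,
      inter_eq_self_of_subset_right
        (Icc_subset_Ioi_iff one_le_two |>.2 hx.2)]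
  rw [lintegral_powMeasure] at hT
  have hT' := (lintegral_mono_set (Ioo_subset_Ioi_self (a := 1) (b := (0 : ℝ)))).trans_lt hT
  have hEq : ∫⁻ x in Ioo 0 1, ENNReal.ofReal (x ^ δ) * ENNReal.ofReal |Hinf ξ f x| ^ p =
      ∫⁻ x in Ioo 0 1, ENNReal.ofReal (c ^ p) * ENNReal.ofReal (x ^ (δ + ξ * p)) := by
    refine setLIntegral_congr_fun measurableSet_Ioo fun x hx => ?_
    have hx0 : 0 < x := hx.1
    rw [hH hx, abs_of_nonneg (by positivity), ENNReal.ofReal_rpow_of_nonneg (by positivity) hp0.le,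
      ← ENNReal.ofReal_mul (by positivity), ← ENNReal.ofReal_mul (by positivity),
      Real.mul_rpow (by positivity) hc.le, ← Real.rpow_mul hx0.le, ← mul_assoc,
      ← Real.rpow_add hx0, mul_comm]
  rw [hEq, lintegral_const_mul _ (by fun_prop)] at hT'
  have hlt := ENNReal.lt_top_of_mul_ne_top_right hT'.ne
    (ENNReal.ofReal_pos.2 (by positivity)).ne'
  have hi : IntegrableOn (fun x : ℝ => x ^ (δ + ξ * p)) (Ioo 0 1) := by
    refine ⟨by fun_prop, ?_⟩
    rw [hasFiniteIntegral_iff_ofReal]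
    · exact hlt
    · filter_upwards [ae_restrict_mem measurableSet_Ioo] with x hx
      exact Real.rpow_nonneg hx.1.le _
  linarith [(intervalIntegral.integrableOn_Ioo_rpow_iff one_pos).1 hi]

theorem pos_of_isStrongTypeInfty_Hinf {ξ : ℝ} (h : IsStrongTypeInfty (Hinf ξ)) : 0 < ξ := by
  by_contra! hξ
  obtain ⟨C, hC⟩ := h
  set f : ℝ → ℝ := (Iic 1).indicator 1
  have hlog {x : ℝ} (hx : x ∈ Ioo (0 : ℝ) 1) : -Real.log x ≤ Hinf ξ f x := by
    have hx0 : 0 < x := hx.1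
    have hI (r : ℝ) : IntervalIntegrable (fun y : ℝ => y ^ r) volume x 1 :=
      intervalIntegral.intervalIntegrable_rpow (Or.inr (notMem_uIcc_of_lt hx0 one_pos))
    rw [Hinf_indicator_one ξ measurableSet_Iic, Ioi_inter_Iic,
      ← intervalIntegral.integral_of_le hx.2.le, ← intervalIntegral.integral_const_mul,
      ← Real.log_inv, ← one_div, ← integral_inv_of_pos hx0 one_pos]
    refine intervalIntegral.integral_mono_on hx.2.le (by simpa [Real.rpow_neg_one] using hI (-1))
      ((hI _).const_mul _) fun y hy => ?_
    have hy0 : 0 < y := hx0.trans_le hy.1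
    calc y⁻¹ = y ^ ξ * y ^ (-ξ - 1) := by
          rw [← Real.rpow_add hy0, ← Real.rpow_neg_one]; ring_nf
      _ ≤ x ^ ξ * y ^ (-ξ - 1) := by
          exact mul_le_mul_of_nonneg_right (Real.rpow_le_rpow_of_nonpos hx0 hy.1 hξ) (by positivity)
  have hf : eLpNorm f ⊤ (volume.restrict (Ioi (0 : ℝ))) ≤ 1 := by
    rw [eLpNorm_exponent_top]
    refine essSup_le_of_ae_le _ (Filter.Eventually.of_forall fun x => ?_)
    by_cases hx : x ∈ Iic (1 : ℝ) <;> simp [f, hx]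
  have hb : ∀ᵐ x ∂volume.restrict (Ioi (0 : ℝ)), ‖Hinf ξ f x‖ₑ ≤ C := by
    have := (hC f).trans (mul_le_mul_right hf _)
    rw [mul_one, eLpNorm_exponent_top] at this
    filter_upwards [enorm_ae_le_eLpNormEssSup (Hinf ξ f) (volume.restrict (Ioi (0 : ℝ)))] with x hx
    exact hx.trans this
  set ε : ℝ := Real.exp (-(C + 1))
  have hε1 : ε ≤ 1 := Real.exp_le_one_iff.2 (by linarith [C.coe_nonneg])
  have hb' : ∀ᵐ x ∂volume.restrict (Ioo (0 : ℝ) ε), False := by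
    filter_upwards [ae_restrict_of_ae_restrict_of_subset Ioo_subset_Ioi_self hb,
      ae_restrict_mem measurableSet_Ioo] with x hx hxε
    have h1 := hlog ⟨hxε.1, hxε.2.trans_le hε1⟩
    have h2 : Real.log x < -(C + 1) := (Real.log_lt_iff_lt_exp hxε.1).2 hxε.2
    have h3 : |Hinf ξ f x| ≤ C := by
      rwa [Real.enorm_eq_ofReal_abs, ENNReal.ofReal_le_coe] at hx
    linarith [le_abs_self (Hinf ξ f x)]
  rw [Filter.eventually_false_iff_eq_bot, ae_eq_bot, Measure.restrict_eq_zero] at hb'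
  simp [ε, (Real.exp_pos _).not_ge] at hb'

theorem stmt3 (ξ δ p : ℝ) (hp : 1 ≤ p) :
    (IsStrongType (Hinf ξ) p δ ↔ -ξ * p - 1 < δ) ∧
    (IsStrongTypeInfty (Hinf ξ) ↔ 0 < ξ) :=
  ⟨⟨lt_of_isStrongType_Hinf hp, isStrongType_Hinf hp⟩,
    pos_of_isStrongTypeInfty_Hinf, isStrongTypeInfty_Hinf⟩

end
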